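/- Let k ≥ 0, ℓ ≥ 1 and λ ∈ P_ℓ^k. Then the K-k-Schur function of weight 1 equals the K-k-Schur function, ĝ_λ^{(1)} = g_λ^{(k)}, and the K-k-Schur function of weight bot_λ + 1 equals the closed k-Schur Katalan function, ĝ_λ^{(bot_λ+1)} = 𝔤_λ^{(k)}. -/

import Mathlib

open scoped Classical

noncomputable section

/-- The ambient ring: formal power series over ℚ in countably many variables. -/
abbrev R : Type := MvPowerSeries ℕ ℚ

/-- The complete homogeneous symmetric function `h_m` (equal to `0` for `m < 0`):
its coefficient at a monomial is `1` if the monomial has total degree `m`, else `0`. -/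
def hh (m : ℤ) : R := fun d => if ((d.sum fun _ e => (e : ℤ)) = m) then 1 else 0

/-- The inhomogeneous analogue `k_m^{(r)} = ∑_{i=0}^{m} C(r+i−1, i) · h_{m−i}`. -/
def kk (r : ℕ) (m : ℤ) : R :=
  ∑ i ∈ Finset.range (m.toNat + 1), ((r + i - 1).choose i : ℚ) • hh (m - (i : ℤ))

/-- The dual stable Grothendieck polynomial `g_γ`, as an `ℓ × ℓ` determinant with
`(i,j)` entry `k_{γ_i + j − i}^{(i−1)}` (indices 1-based). -/
def gg (ℓ : ℕ) (γ : ℕ → ℤ) : R :=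
  (Matrix.of fun i j : Fin ℓ =>
    kk i.val (γ (i.val + 1) + (j.val : ℤ) - (i.val : ℤ))).det

/-- The `i`-th standard basis vector `ε_i`. -/
def eps (i : ℕ) : ℕ → ℤ := fun x => if x = i then 1 else 0

/-- The Katalan function `K(Ψ; M; γ)`. -/
def katalan (ℓ : ℕ) (Ψ : Finset (ℕ × ℕ)) (M : Multiset ℕ) (γ : ℕ → ℤ) : R :=
  (M.powerset.map fun S =>
    (-1 : R) ^ Multiset.card S *
      ∑ᶠ α : {p // p ∈ Ψ} → ℕ,
        gg ℓ (fun x =>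
          γ x + (∑ p ∈ Ψ.attach, (α p : ℤ) * (eps p.1.1 x - eps p.1.2 x))
            - (S.map fun z => eps z x).sum)).sum

/-- The set of positive roots `Δ_ℓ^+ = {(i,j) : 1 ≤ i < j ≤ ℓ}`. -/
def DeltaPlus (ℓ : ℕ) : Finset (ℕ × ℕ) :=
  (Finset.Icc 1 ℓ ×ˢ Finset.Icc 1 ℓ).filter fun p => p.1 < p.2

/-- A root ideal: an upper order ideal of `Δ_ℓ^+`. -/
def IsRootIdeal (ℓ : ℕ) (Ψ : Finset (ℕ × ℕ)) : Prop :=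
  Ψ ⊆ DeltaPlus ℓ ∧
    ∀ a b c d : ℕ, (a, b) ∈ Ψ → (c, d) ∈ DeltaPlus ℓ → c ≤ a → b ≤ d → (c, d) ∈ Ψ

/-- The root ideal `Δ^k(λ) = {(i,j) ∈ Δ_ℓ^+ : j > k − λ_i + i}`. -/
def DeltaK (k ℓ : ℕ) (lam : ℕ → ℤ) : Finset (ℕ × ℕ) :=
  (DeltaPlus ℓ).filter fun p => (k : ℤ) - lam p.1 + (p.1 : ℤ) < (p.2 : ℤ)

/-- `bot(Ψ)`: the largest `x` such that row `x` of `Ψ` is nonempty (`0` if `Ψ = ∅`). -/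
def botIdeal (Ψ : Finset (ℕ × ℕ)) : ℕ := Ψ.sup Prod.fst

/-- `bot_λ := bot(Δ^k(λ))`. -/
def botL (k ℓ : ℕ) (lam : ℕ → ℤ) : ℕ := botIdeal (DeltaK k ℓ lam)

/-- A removable root of a root ideal. -/
def IsRemovable (ℓ : ℕ) (Ψ : Finset (ℕ × ℕ)) (α : ℕ × ℕ) : Prop :=
  α ∈ Ψ ∧ IsRootIdeal ℓ (Ψ.erase α)

/-- `down_Ψ(x)` is defined, i.e. row `x` of `Ψ` contains a removable root. -/
def HasDown (ℓ : ℕ) (Ψ : Finset (ℕ × ℕ)) (x : ℕ) : Prop :=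
  ∃ j, IsRemovable ℓ Ψ (x, j)

/-- `down_Ψ(x)`: the column of the removable root in row `x` (junk value `0` if
row `x` has no removable root). -/
def down (ℓ : ℕ) (Ψ : Finset (ℕ × ℕ)) (x : ℕ) : ℕ :=
  ((Ψ.filter fun p => p.1 = x ∧ IsRemovable ℓ Ψ p).image Prod.snd).sup id

/-- `down_λ := down_{Δ^k(λ)}`. -/
def downL (k ℓ : ℕ) (lam : ℕ → ℤ) : ℕ → ℕ := down ℓ (DeltaK k ℓ lam)

/-- The `a`-fold iterate `down_Ψ^a(x)` is defined. -/
def DownIterDefined (ℓ : ℕ) (Ψ : Finset (ℕ × ℕ)) (a x : ℕ) : Prop :=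
  ∀ b < a, HasDown ℓ Ψ ((down ℓ Ψ)^[b] x)

/-- `L(ℛ)`: the multiset of second components of `ℛ`, with multiplicity. -/
def Lmul (ℛ : Finset (ℕ × ℕ)) : Multiset ℕ := ℛ.val.map Prod.snd

/-- `λ ∈ P_ℓ^k`: a `k`-bounded partition with `ℓ` parts allowed to be zero. -/
def IsKBounded (k ℓ : ℕ) (lam : ℕ → ℤ) : Prop :=
  lam 1 ≤ (k : ℤ) ∧ (∀ i, 1 ≤ i → i < ℓ → lam (i + 1) ≤ lam i) ∧ 0 ≤ lam ℓ

/-- The multiset `M_z(λ)`: `L(Δ^k(λ))` with one occurrence of `down_λ(x)` removed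
for each `x ∈ [z, bot_λ]`. -/
def Mz (k ℓ : ℕ) (lam : ℕ → ℤ) (z : ℕ) : Multiset ℕ :=
  Lmul (DeltaK k ℓ lam) - ((Finset.Icc z (botL k ℓ lam)).val.map (downL k ℓ lam))

/-- The `K`-`k`-Schur function of weight `z`: `ĝ_λ^{(z)} = K(Δ^k(λ); M_z(λ); λ)`. -/
def wkschur (k ℓ : ℕ) (lam : ℕ → ℤ) (z : ℕ) : R :=
  katalan ℓ (DeltaK k ℓ lam) (Mz k ℓ lam z) lam

/-- The `K`-`k`-Schur function `g_λ^{(k)} = K(Δ^k(λ); L(Δ^{k+1}(λ)); λ)`. -/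
def kkschur (k ℓ : ℕ) (lam : ℕ → ℤ) : R :=
  katalan ℓ (DeltaK k ℓ lam) (Lmul (DeltaK (k + 1) ℓ lam)) lam

/-- The closed `k`-Schur Katalan function `𝔤_λ^{(k)} = K(Δ^k(λ); L(Δ^k(λ)); λ)`. -/
def closedkschur (k ℓ : ℕ) (lam : ℕ → ℤ) : R :=
  katalan ℓ (DeltaK k ℓ lam) (Lmul (DeltaK k ℓ lam)) lam

/-- `|λ| = λ_1 + ⋯ + λ_ℓ`. -/
def psize (ℓ : ℕ) (lam : ℕ → ℤ) : ℤ := ∑ i ∈ Finset.Icc 1 ℓ, lam i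

theorem IsKBounded.antitone {k ℓ : ℕ} {lam : ℕ → ℤ} (h : IsKBounded k ℓ lam) {i j : ℕ}
    (hi : 1 ≤ i) (hij : i ≤ j) (hj : j ≤ ℓ) : lam j ≤ lam i := by
  induction j, hij using Nat.le_induction with
  | base => exact le_rfl
  | succ n hn ih => exact (h.2.1 n (hi.trans hn) (by omega)).trans (ih (by omega))

theorem mem_DeltaK {k ℓ : ℕ} {lam : ℕ → ℤ} {a b : ℕ} :
    (a, b) ∈ DeltaK k ℓ lam ↔ 1 ≤ a ∧ a < b ∧ b ≤ ℓ ∧ (k : ℤ) - lam a + a < b := by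
  simp only [DeltaK, DeltaPlus, Finset.mem_filter, Finset.mem_product, Finset.mem_Icc]
  omega

/-- The removable roots of `Δ^k(λ)` are the leftmost roots of its nonempty rows. -/
theorem isRemovable_DeltaK_iff {k ℓ : ℕ} {lam : ℕ → ℤ} (h : IsKBounded k ℓ lam) {x j : ℕ} :
    IsRemovable ℓ (DeltaK k ℓ lam) (x, j) ↔
      1 ≤ x ∧ x ≤ ℓ ∧ j ≤ ℓ ∧ (j : ℤ) = k - lam x + x + 1 := by
  constructor
  · rintro ⟨hmem, -, hup⟩
    have hm := mem_DeltaK.1 hmem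
    have hx := h.antitone le_rfl hm.1 (by omega)
    have hk := h.1
    refine ⟨hm.1, by omega, hm.2.2.1, ?_⟩
    by_contra hne
    refine Finset.notMem_erase (x, j) (DeltaK k ℓ lam) (hup x (j - 1) x j ?_ ?_ le_rfl (by omega))
    · rw [Finset.mem_erase, mem_DeltaK, Ne, Prod.mk.injEq]
      omega
    · exact (Finset.mem_filter.1 hmem).1
  · rintro ⟨hx1, hxl, hjl, hj⟩
    have hk := h.1
    have hx := h.antitone le_rfl hx1 hxl
    refine ⟨mem_DeltaK.2 (by omega), fun p hp => ?_, ?_⟩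
    · exact (Finset.mem_filter.1 (Finset.mem_of_mem_erase hp)).1
    · intro a b c d hab hcd hca hbd
      rw [Finset.mem_erase, mem_DeltaK, Ne, Prod.mk.injEq] at hab
      simp only [DeltaPlus, Finset.mem_filter, Finset.mem_product, Finset.mem_Icc] at hcd
      have hac := h.antitone hcd.1.1.1 hca (by omega)
      rw [Finset.mem_erase, mem_DeltaK, Ne, Prod.mk.injEq]
      refine ⟨?_, by omega⟩
      rintro ⟨rfl, rfl⟩
      rcases hca.eq_or_lt with rfl | hlt <;> omega

theorem downL_eq {k ℓ : ℕ} {lam : ℕ → ℤ} (h : IsKBounded k ℓ lam) {x j : ℕ}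
    (hr : IsRemovable ℓ (DeltaK k ℓ lam) (x, j)) : downL k ℓ lam x = j := by
  have hfilter : ((DeltaK k ℓ lam).filter fun p =>
      p.1 = x ∧ IsRemovable ℓ (DeltaK k ℓ lam) p) = {(x, j)} := by
    ext ⟨a, b⟩
    rw [Finset.mem_filter, Finset.mem_singleton, Prod.mk.injEq]
    constructor
    · rintro ⟨-, hax, hb⟩
      replace hax : a = x := hax
      subst hax
      have h1 := (isRemovable_DeltaK_iff h).1 hr
      have h2 := (isRemovable_DeltaK_iff h).1 hb
      omega
    · rintro ⟨rfl, rfl⟩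
      exact ⟨hr.1, rfl, hr⟩
  simp [downL, down, hfilter]

/-- Every row of `Δ^k(λ)` in `[1, bot_λ]` contains a removable root. -/
theorem isRemovable_downL {k ℓ : ℕ} {lam : ℕ → ℤ} (h : IsKBounded k ℓ lam) {x : ℕ}
    (hx : x ∈ Finset.Icc 1 (botL k ℓ lam)) :
    IsRemovable ℓ (DeltaK k ℓ lam) (x, downL k ℓ lam x) := by
  rw [Finset.mem_Icc] at hx
  obtain ⟨⟨a, b⟩, hab, hxa⟩ :=
    (Finset.le_sup_iff (f := Prod.fst) (s := DeltaK k ℓ lam) (by simp; omega)).1 hx.2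
  rw [mem_DeltaK] at hab
  replace hxa : x ≤ a := hxa
  have hk := h.1
  have h1 := h.antitone le_rfl hx.1 (by omega)
  have h2 := h.antitone hx.1 hxa (by omega)
  have hr : IsRemovable ℓ (DeltaK k ℓ lam) (x, ((k : ℤ) - lam x + x + 1).toNat) :=
    (isRemovable_DeltaK_iff h).2 (by omega)
  rwa [downL_eq h hr]

theorem Lmul_DeltaK_eq_add {k ℓ : ℕ} {lam : ℕ → ℤ} (h : IsKBounded k ℓ lam) :
    Lmul (DeltaK k ℓ lam) = Lmul (DeltaK (k + 1) ℓ lam) +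
      (Finset.Icc 1 (botL k ℓ lam)).val.map (downL k ℓ lam) := by
  let rows : ℕ ↪ ℕ × ℕ := ⟨fun x => (x, downL k ℓ lam x), fun _ _ hab => (Prod.mk.inj hab).1⟩
  have hdisj : Disjoint (DeltaK (k + 1) ℓ lam) ((Finset.Icc 1 (botL k ℓ lam)).map rows) := by
    rw [Finset.disjoint_right]
    intro p hp hmem
    obtain ⟨x, hx, rfl⟩ := Finset.mem_map.1 hp
    have h1 := (isRemovable_DeltaK_iff h).1 (isRemovable_downL h hx)
    have h2 := mem_DeltaK.1 hmem
    push_cast at h2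
    omega
  have hunion : DeltaK k ℓ lam = (DeltaK (k + 1) ℓ lam).disjUnion
      ((Finset.Icc 1 (botL k ℓ lam)).map rows) hdisj := by
    ext ⟨a, b⟩
    rw [Finset.mem_disjUnion]
    constructor
    · intro hab
      by_cases hab' : (a, b) ∈ DeltaK (k + 1) ℓ lam
      · exact Or.inl hab'
      have h1 := mem_DeltaK.1 hab
      rw [mem_DeltaK] at hab'
      push_cast at hab'
      have ha : a ∈ Finset.Icc 1 (botL k ℓ lam) :=
        Finset.mem_Icc.2 ⟨h1.1, Finset.le_sup (f := Prod.fst) hab⟩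
      have hr : IsRemovable ℓ (DeltaK k ℓ lam) (a, b) :=
        (isRemovable_DeltaK_iff h).2 (by omega)
      exact Or.inr (Finset.mem_map.2 ⟨a, ha, congrArg (Prod.mk a) (downL_eq h hr)⟩)
    · rintro (hab | hab)
      · rw [mem_DeltaK] at hab ⊢
        push_cast at hab
        omega
      · obtain ⟨x, hx, hxab⟩ := Finset.mem_map.1 hab
        exact hxab ▸ (isRemovable_downL h hx).1
  have hmap := congrArg (fun s : Finset (ℕ × ℕ) => s.val.map Prod.snd) hunion
  simp only [Finset.disjUnion_val, Multiset.map_add, Finset.map_val, Multiset.map_map] at hmap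
  exact hmap

/-- `ĝ_λ^{(1)} = g_λ^{(k)}` and `ĝ_λ^{(bot_λ+1)} = 𝔤_λ^{(k)}`. -/
theorem statement2 (k ℓ : ℕ) (hℓ : 1 ≤ ℓ) (lam : ℕ → ℤ) (hlam : IsKBounded k ℓ lam) :
    wkschur k ℓ lam 1 = kkschur k ℓ lam ∧
    wkschur k ℓ lam (botL k ℓ lam + 1) = closedkschur k ℓ lam := by
  refine ⟨?_, ?_⟩
  · rw [wkschur, kkschur, Mz, Lmul_DeltaK_eq_add hlam, add_tsub_cancel_right]
  · rw [wkschur, closedkschur, Mz, Finset.Icc_eq_empty (by omega), Finset.empty_val,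
      Multiset.map_zero, tsub_zero]

end
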